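/- For n = 3 and p = q = 1, the tube manifold 𝒯_{1,1} ⊆ Matrix (Fin 3) (Fin 3) ℂ is path-connected and its fundamental group at any basepoint is isomorphic to the quaternion group Q₈ of order 8 (Mathlib's QuaternionGroup 2): for every x ∈ 𝒯_{1,1} there is a group isomorphism FundamentalGroup 𝒯_{1,1} x ≃* QuaternionGroup 2. -/

import Mathlib

open Matrix

/-- The diagonal matrix `D_{p,q}` with `p` entries `1`, then `q` entries `−1`, then zeros. -/
def signatureDiag (n p q : ℕ) : Matrix (Fin n) (Fin n) ℝ :=
  Matrix.diagonal (fun i => if (i : ℕ) < p then (1 : ℝ) else if (i : ℕ) < p + q then -1 else 0)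

/-- The cone `𝒞_{p,q}` of real symmetric `n×n` matrices of signature `(p,q)`. -/
def sigCone (n p q : ℕ) : Set (Matrix (Fin n) (Fin n) ℝ) :=
  {x | ∃ g : Matrix (Fin n) (Fin n) ℝ, IsUnit g ∧ x = g * signatureDiag n p q * gᵀ}

/-- The tube manifold `𝒯_{p,q} = 𝒞_{p,q} ⊕ iV` of symmetric complex matrices `z`
whose real part `(z + z̄)/2` lies in `𝒞_{p,q}`. -/
def sigTube (n p q : ℕ) : Set (Matrix (Fin n) (Fin n) ℂ) :=
  {z | zᵀ = z ∧
    (Matrix.of fun i j => ((z + z.map (starRingEnd ℂ)) i j).re / 2) ∈ sigCone n p q}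

section AuxMaterial


/-- The complement of the origin is simply connected in dimension at least three. -/
theorem aux_simplyConnected_compl_zero {F : Type} [NormedAddCommGroup F] [NormedSpace ℝ F]
    [FiniteDimensional ℝ F] (hF : 2 < Module.finrank ℝ F) :
    SimplyConnectedSpace ({0}ᶜ : Set F) := by
  rw [simply_connected_iff_loops_nullhomotopic]
  constructor
  · rw [← isPathConnected_iff_pathConnectedSpace]
    apply isPathConnected_compl_singleton_of_one_lt_rank
    rw [← Module.finrank_eq_rank]
    exact_mod_cast (by omega : 1 < Module.finrank ℝ F)
  intro x γ
  -- lower bound for the norm along the loop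
  obtain ⟨t₀, -, ht₀⟩ := isCompact_univ.exists_isMinOn (s := (Set.univ : Set unitInterval))
    Set.univ_nonempty (f := fun t => ‖(γ t : F)‖) (by fun_prop)
  set δ : ℝ := ‖(γ t₀ : F)‖ with hδ
  have hδpos : 0 < δ := norm_pos_iff.2 (γ t₀).2
  have hmin : ∀ t, δ ≤ ‖(γ t : F)‖ := fun t => ht₀ (Set.mem_univ t)
  have hcont : Continuous fun t : ℝ => (γ.extend t : F) := by fun_prop
  obtain ⟨g, hgs, hg, -⟩ := hcont.exists_contDiff_approx (n := 1) (ε := fun _ => δ / 3)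
    continuous_const (fun _ => by positivity)
  have hg' : ∀ t : unitInterval, ‖g t - γ t‖ < δ / 3 := by
    intro t
    have := hg (t : ℝ)
    rwa [dist_eq_norm, Path.extend_apply _ t.2] at this
  have e0 : ‖g 0 - (x : F)‖ < δ / 3 := by simpa using hg' 0
  have e1 : ‖g 1 - (x : F)‖ < δ / 3 := by simpa using hg' 1
  set q : ℝ → F := fun t => g t - ((1 - t) • (g 0 - (x : F)) + t • (g 1 - (x : F))) with hq
  have hqs : ContDiff ℝ 1 q := by
    have : ContDiff ℝ 1 g := by exact_mod_cast hgs
    fun_prop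
  have hqc : Continuous q := hqs.continuous
  have hq0 : q 0 = x := by simp [hq]
  have hq1 : q 1 = x := by simp [hq]
  have hqd : ∀ t : unitInterval, ‖q t - γ t‖ < δ := by
    intro t
    have h1 := hg' t
    have h0' : ‖(1 - (t : ℝ)) • (g 0 - (x : F))‖ ≤ (1 - t) * (δ / 3) := by
      rw [norm_smul, Real.norm_of_nonneg (by linarith [t.2.2])]
      exact mul_le_mul_of_nonneg_left e0.le (by linarith [t.2.2])
    have h1' : ‖(t : ℝ) • (g 1 - (x : F))‖ ≤ t * (δ / 3) := by
      rw [norm_smul, Real.norm_of_nonneg t.2.1]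
      exact mul_le_mul_of_nonneg_left e1.le t.2.1
    have : q t - γ t = (g t - γ t) - ((1 - (t : ℝ)) • (g 0 - (x : F)) + (t : ℝ) • (g 1 - (x : F))) := by
      simp only [hq]; abel
    rw [this]
    refine (norm_sub_le _ _).trans_lt ?_
    have := norm_add_le ((1 - (t : ℝ)) • (g 0 - (x : F))) ((t : ℝ) • (g 1 - (x : F)))
    linarith
  have hne : ∀ (s t : unitInterval), (1 - (s : ℝ)) • (γ t : F) + (s : ℝ) • q t ≠ 0 := by
    intro s t h0
    have h1 : (γ t : F) = - ((s : ℝ) • (q t - γ t)) := by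
      have h3 : (γ t : F) + (s : ℝ) • (q t - γ t) = 0 := by
        refine Eq.trans ?_ h0
        module
      exact eq_neg_of_add_eq_zero_left h3
    have h2 : ‖(γ t : F)‖ ≤ ‖q t - γ t‖ := by
      conv_lhs => rw [h1]
      rw [norm_neg, norm_smul, Real.norm_of_nonneg s.2.1]
      exact mul_le_of_le_one_left (norm_nonneg _) s.2.2
    linarith [hmin t, hqd t]
  have hqne : ∀ t : unitInterval, q t ≠ 0 := by
    intro t; simpa using hne 1 t
  -- a direction avoided by `q`
  obtain ⟨v, hv⟩ : ∃ v : F, v ∉ Set.range (fun p : ℝ × ℝ => p.1 • q p.2) := by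
    have hd := ContDiff.dense_compl_range_of_finrank_lt_finrank
      (f := fun p : ℝ × ℝ => p.1 • q p.2) (by fun_prop) (by simpa using hF)
    exact hd.nonempty
  have hv0 : v ≠ 0 := by
    rintro rfl
    exact hv ⟨(0, 0), by simp⟩
  set U : Set F := {w | ∀ s : ℝ, 0 ≤ s → w ≠ -(s • v)} with hU
  have hvU : v ∈ U := by
    intro s hs h
    have : (1 + s) • v = 0 := by rw [add_smul, one_smul]; nth_rewrite 1 [h]; simp
    rcases smul_eq_zero.1 this with h | h
    · linarith
    · exact hv0 h
  have hstar : StarConvex ℝ v U := by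
    intro w hw a b ha hb hab s hs h
    rcases hb.eq_or_lt with rfl | hb
    · have : a = 1 := by linarith
      subst this
      exact hvU s hs (by simpa using h)
    · apply hw ((s + a) / b) (by positivity)
      have : b • w = -((s + a) • v) := by
        rw [add_smul, neg_add, ← h]; abel
      rw [div_eq_inv_mul, mul_smul, ← smul_neg, ← this, smul_smul, inv_mul_cancel₀ hb.ne', one_smul]
  have hUc : ContractibleSpace U := hstar.contractibleSpace ⟨v, hvU⟩
  have hqU : ∀ t, q t ≠ 0 → q t ∈ U := by
    intro t ht s hs h
    rcases hs.eq_or_lt with rfl | hs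
    · simp at h; exact ht h
    · apply hv
      refine ⟨(-s⁻¹, t), ?_⟩
      simp only [h, smul_neg, smul_smul, neg_mul, inv_mul_cancel₀ hs.ne', neg_smul, one_smul, neg_neg]
  have hU0 : ∀ w ∈ U, w ∈ ({0}ᶜ : Set F) := by
    intro w hw h
    exact hw 0 le_rfl (by simpa using h)
  have hxU : (x : F) ∈ U := by
    rw [← hq0]; exact hqU 0 (by rw [hq0]; exact x.2)
  let qU : Path (⟨x, hxU⟩ : U) ⟨x, hxU⟩ :=
    { toFun := fun t => ⟨q t, hqU t (hqne t)⟩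
      continuous_toFun := by fun_prop
      source' := by simp [hq0]
      target' := by simp [hq1] }
  let j : C(U, ({0}ᶜ : Set F)) := ⟨fun w => ⟨w, hU0 w w.2⟩, by fun_prop⟩
  have h2 : Path.Homotopic (qU.map j.continuous) ((Path.refl (⟨x, hxU⟩ : U)).map j.continuous) :=
    (SimplyConnectedSpace.paths_homotopic qU (Path.refl _)).map j
  let q' : Path x x :=
    { toFun := fun t => ⟨q t, hqne t⟩
      continuous_toFun := by fun_prop
      source' := by simp [hq0]
      target' := by simp [hq1] }
  have h2' : Path.Homotopic q' (Path.refl x) := h2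
  refine Path.Homotopic.trans ⟨?_⟩ h2'
  exact
    { toFun := fun p => ⟨(1 - (p.1 : ℝ)) • (γ p.2 : F) + (p.1 : ℝ) • q p.2, hne p.1 p.2⟩
      continuous_toFun := by fun_prop
      map_zero_left := by intro t; ext; simp
      map_one_left := by intro t; ext; simp [q']
      prop' := by
        rintro s t (rfl | rfl)
        · apply Subtype.ext; simp [hq0]; module
        · apply Subtype.ext; simp [hq1]; module }

theorem aux_simplyConnected_of_prod {X Y : Type} [TopologicalSpace X] [TopologicalSpace Y]
    [ContractibleSpace Y] : SimplyConnectedSpace (X × Y) ↔ SimplyConnectedSpace X := by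
  obtain ⟨h⟩ := ContractibleSpace.hequiv_unit Y
  exact (((ContinuousMap.HomotopyEquiv.refl X).prodCongr h).trans
    (Homeomorph.prodPUnit X).toHomotopyEquiv).simplyConnectedSpace_iff

open Quaternion in
theorem aux_sphere_sc : SimplyConnectedSpace (Metric.sphere (0 : ℍ[ℝ]) 1) := by
  have h := aux_simplyConnected_compl_zero (F := ℍ[ℝ]) (by rw [Quaternion.finrank_eq_four]; norm_num)
  have : ContractibleSpace (Set.Ioi (0:ℝ)) := (convex_Ioi (0:ℝ)).contractibleSpace ⟨1, by simp⟩
  rw [← aux_simplyConnected_of_prod (Y := Set.Ioi (0:ℝ))]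
  exact (homeomorphUnitSphereProd ℍ[ℝ]).symm.toHomotopyEquiv.simplyConnectedSpace

open Quaternion

/-- The (unnormalised) rotation matrix of a quaternion. -/
def auxR (q : ℍ[ℝ]) : Matrix (Fin 3) (Fin 3) ℝ :=
  !![q.re ^ 2 + q.imI ^ 2 - q.imJ ^ 2 - q.imK ^ 2, 2 * (q.imI * q.imJ - q.re * q.imK),
      2 * (q.imI * q.imK + q.re * q.imJ);
    2 * (q.imI * q.imJ + q.re * q.imK), q.re ^ 2 - q.imI ^ 2 + q.imJ ^ 2 - q.imK ^ 2,
      2 * (q.imJ * q.imK - q.re * q.imI);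
    2 * (q.imI * q.imK - q.re * q.imJ), 2 * (q.imJ * q.imK + q.re * q.imI),
      q.re ^ 2 - q.imI ^ 2 - q.imJ ^ 2 + q.imK ^ 2]

theorem auxR_mul (p q : ℍ[ℝ]) : auxR (p * q) = auxR p * auxR q := by
  ext i j
  fin_cases i <;> fin_cases j <;>
    simp [auxR, Matrix.mul_apply, Fin.sum_univ_three] <;> ring

theorem aux_sphere_sq (u : Metric.sphere (0 : ℍ[ℝ]) 1) :
    (u : ℍ[ℝ]).re ^ 2 + (u : ℍ[ℝ]).imI ^ 2 + (u : ℍ[ℝ]).imJ ^ 2 + (u : ℍ[ℝ]).imK ^ 2 = 1 := by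
  have h : ‖(u : ℍ[ℝ])‖ = 1 := by simp
  rw [← Quaternion.normSq_def', Quaternion.normSq_eq_norm_mul_self, h, one_mul]

theorem auxR_orth (u : Metric.sphere (0 : ℍ[ℝ]) 1) : auxR u * (auxR u)ᵀ = 1 := by
  have h := aux_sphere_sq u
  ext i j
  fin_cases i <;> fin_cases j <;>
    simp [auxR, Matrix.mul_apply, Fin.sum_univ_three] <;> grind

theorem auxR_orth' (u : Metric.sphere (0 : ℍ[ℝ]) 1) : (auxR u)ᵀ * auxR u = 1 :=
  mul_eq_one_comm.1 (auxR_orth u)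

theorem auxR_cont : Continuous auxR := by
  unfold auxR
  refine continuous_matrix fun i j => ?_
  have := Quaternion.continuous_re
  have := Quaternion.continuous_imI
  have := Quaternion.continuous_imJ
  have := Quaternion.continuous_imK
  fin_cases i <;> fin_cases j <;> simp <;> fun_prop

/-- quaternion from its coordinates -/
def auxQ (a b c d : ℝ) : ℍ[ℝ] := ⟨a, b, c, d⟩

theorem auxQ_re (a b c d : ℝ) : (auxQ a b c d).re = a := rfl
theorem auxQ_imI (a b c d : ℝ) : (auxQ a b c d).imI = b := rfl
theorem auxQ_imJ (a b c d : ℝ) : (auxQ a b c d).imJ = c := rfl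
theorem auxQ_imK (a b c d : ℝ) : (auxQ a b c d).imK = d := rfl

/-- unit quaternion from its coordinates -/
def auxU (a b c d : ℝ) (h : a ^ 2 + b ^ 2 + c ^ 2 + d ^ 2 = 1) : Metric.sphere (0 : ℍ[ℝ]) 1 :=
  ⟨auxQ a b c d, by
    rw [mem_sphere_zero_iff_norm, ← sq_eq_sq₀ (norm_nonneg _) zero_le_one, pow_two,
      ← Quaternion.normSq_eq_norm_mul_self, Quaternion.normSq_def', auxQ_re, auxQ_imI, auxQ_imJ,
      auxQ_imK]
    simpa using h⟩

/-- `S³ → SO(3)` is onto, main case. -/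
theorem auxR_surj0 (M : Matrix (Fin 3) (Fin 3) ℝ) (h1 : M * Mᵀ = 1) (h2 : M.det = 1)
    (h3 : 0 < 1 + M.trace) : ∃ u : Metric.sphere (0 : ℍ[ℝ]) 1, auxR u = M := by
  have h1' : Mᵀ * M = 1 := mul_eq_one_comm.1 h1
  have hadj : M.adjugate = Mᵀ := by
    have := congrArg (· * M.adjugate) h1'
    simp only [Matrix.mul_assoc, Matrix.mul_adjugate, h2, one_smul, Matrix.mul_one, Matrix.one_mul] at this
    exact this.symm
  have e : ∀ i j, (M * Mᵀ) i j = (1 : Matrix (Fin 3) (Fin 3) ℝ) i j := fun i j => by rw [h1]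
  have e' : ∀ i j, (Mᵀ * M) i j = (1 : Matrix (Fin 3) (Fin 3) ℝ) i j := fun i j => by rw [h1']
  have a : ∀ i j, M.adjugate i j = M j i := fun i j => by rw [hadj]; rfl
  have e00 := e 0 0
  have e01 := e 0 1
  have e02 := e 0 2
  have e11 := e 1 1
  have e12 := e 1 2
  have e22 := e 2 2
  have f00 := e' 0 0
  have f01 := e' 0 1
  have f02 := e' 0 2
  have f11 := e' 1 1
  have f12 := e' 1 2
  have f22 := e' 2 2
  have a00 := a 0 0
  have a01 := a 0 1
  have a02 := a 0 2
  have a10 := a 1 0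
  have a11 := a 1 1
  have a12 := a 1 2
  have a20 := a 2 0
  have a21 := a 2 1
  have a22 := a 2 2
  simp only [Matrix.adjugate_fin_three, Matrix.mul_apply, Fin.sum_univ_three, Matrix.transpose_apply,
    Matrix.one_apply] at e00 e01 e02 e11 e12 e22 f00 f01 f02 f11 f12 f22 a00 a01 a02 a10 a11 a12 a20 a21 a22
  simp at e00 e01 e02 e11 e12 e22 f00 f01 f02 f11 f12 f22 a00 a01 a02 a10 a11 a12 a20 a21 a22
  rw [Matrix.trace_fin_three] at h3
  clear h1 h1' h2 hadj e e' a
  obtain ⟨t, ht, hts⟩ : ∃ t : ℝ, 0 < t ∧ 4 * t ^ 2 = 1 + (M 0 0 + M 1 1 + M 2 2) :=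
    ⟨√((1 + (M 0 0 + M 1 1 + M 2 2)) / 4), Real.sqrt_pos.2 (by linarith), by
      rw [Real.sq_sqrt (by linarith)]; ring⟩
  obtain ⟨b, hb⟩ : ∃ b : ℝ, 4 * t * b = M 2 1 - M 1 2 := ⟨(M 2 1 - M 1 2) / (4 * t), by field_simp⟩
  obtain ⟨c, hc⟩ : ∃ b : ℝ, 4 * t * b = M 0 2 - M 2 0 := ⟨(M 0 2 - M 2 0) / (4 * t), by field_simp⟩
  obtain ⟨d, hd⟩ : ∃ b : ℝ, 4 * t * b = M 1 0 - M 0 1 := ⟨(M 1 0 - M 0 1) / (4 * t), by field_simp⟩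
  have key : ∀ x y : ℝ, 16 * t ^ 2 * x = 16 * t ^ 2 * y → x = y := fun x y h =>
    mul_left_cancel₀ (by positivity) h
  have q0 : ∀ x, 16 * t ^ 2 * x = 4 * (1 + (M 0 0 + M 1 1 + M 2 2)) * x := fun x => by rw [← hts]; ring
  have q00 : 16 * t ^ 2 * t ^ 2 = (1 + (M 0 0 + M 1 1 + M 2 2)) ^ 2 := by rw [← hts]; ring
  have q01 : 16 * t ^ 2 * (t * b) = (1 + (M 0 0 + M 1 1 + M 2 2)) * (M 2 1 - M 1 2) := by
    rw [← hts, ← hb]; ring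
  have q02 : 16 * t ^ 2 * (t * c) = (1 + (M 0 0 + M 1 1 + M 2 2)) * (M 0 2 - M 2 0) := by
    rw [← hts, ← hc]; ring
  have q03 : 16 * t ^ 2 * (t * d) = (1 + (M 0 0 + M 1 1 + M 2 2)) * (M 1 0 - M 0 1) := by
    rw [← hts, ← hd]; ring
  have q11 : 16 * t ^ 2 * b ^ 2 = (M 2 1 - M 1 2) ^ 2 := by rw [← hb]; ring
  have q22 : 16 * t ^ 2 * c ^ 2 = (M 0 2 - M 2 0) ^ 2 := by rw [← hc]; ring
  have q33 : 16 * t ^ 2 * d ^ 2 = (M 1 0 - M 0 1) ^ 2 := by rw [← hd]; ring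
  have q12 : 16 * t ^ 2 * (b * c) = (M 2 1 - M 1 2) * (M 0 2 - M 2 0) := by rw [← hb, ← hc]; ring
  have q13 : 16 * t ^ 2 * (b * d) = (M 2 1 - M 1 2) * (M 1 0 - M 0 1) := by rw [← hb, ← hd]; ring
  have q23 : 16 * t ^ 2 * (c * d) = (M 0 2 - M 2 0) * (M 1 0 - M 0 1) := by rw [← hc, ← hd]; ring
  refine ⟨auxU t b c d ?_, ?_⟩
  · apply key
    rw [q0 1]
    linarith
  · ext i j
    apply key
    rw [q0 (M i j)]
    fin_cases i <;> fin_cases j <;>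
      simp [auxR, auxU, auxQ_re, auxQ_imI, auxQ_imJ, auxQ_imK] <;> linarith

theorem auxR_surj (M : Matrix (Fin 3) (Fin 3) ℝ) (h1 : M * Mᵀ = 1) (h2 : M.det = 1) :
    ∃ u : Metric.sphere (0 : ℍ[ℝ]) 1, auxR u = M := by
  have key : ∀ v : Metric.sphere (0 : ℍ[ℝ]) 1, (auxR v).det = 1 →
      0 < 1 + (auxR v * M).trace → ∃ u : Metric.sphere (0 : ℍ[ℝ]) 1, auxR u = M := by
    intro v hv hv'
    obtain ⟨u, hu⟩ := auxR_surj0 (auxR v * M)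
      (by rw [Matrix.transpose_mul, Matrix.mul_assoc, ← Matrix.mul_assoc M, h1, Matrix.one_mul,
        auxR_orth]) (by rw [Matrix.det_mul, hv, h2, one_mul]) hv'
    refine ⟨v⁻¹ * u, ?_⟩
    have h4 : auxR (v⁻¹ : Metric.sphere (0 : ℍ[ℝ]) 1) * auxR v = 1 := by
      rw [← auxR_mul, ← Metric.unitSphere.coe_mul, inv_mul_cancel]
      ext i j
      fin_cases i <;> fin_cases j <;> simp [auxR]
    rw [Metric.unitSphere.coe_mul, auxR_mul, hu, ← Matrix.mul_assoc, h4, Matrix.one_mul]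
  by_contra hcon
  have c0 := fun h h' => hcon (key (auxU 1 0 0 0 (by norm_num)) h h')
  have c1 := fun h h' => hcon (key (auxU 0 1 0 0 (by norm_num)) h h')
  have c2 := fun h h' => hcon (key (auxU 0 0 1 0 (by norm_num)) h h')
  have c3 := fun h h' => hcon (key (auxU 0 0 0 1 (by norm_num)) h h')
  simp [auxR, auxU, auxQ_re, auxQ_imI, auxQ_imJ, auxQ_imK, Matrix.det_fin_three,
    Matrix.trace_fin_three, Matrix.vecMul, dotProduct, Fin.sum_univ_three] at c0 c1 c2 c3
  linarith

/-- conjugates of a diagonal matrix -/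
def auxX (u : Metric.sphere (0 : ℍ[ℝ]) 1) (l m : ℝ) : Matrix (Fin 3) (Fin 3) ℝ :=
  (auxR u)ᵀ * Matrix.diagonal ![l, -m, 0] * auxR u

theorem auxX_apply (u : Metric.sphere (0 : ℍ[ℝ]) 1) (l m : ℝ) (i j : Fin 3) :
    auxX u l m i j = l * auxR u 0 i * auxR u 0 j - m * auxR u 1 i * auxR u 1 j := by
  simp [auxX, Matrix.mul_apply, Fin.sum_univ_three, Matrix.diagonal]
  ring

theorem auxX_cont : Continuous (fun p : Metric.sphere (0 : ℍ[ℝ]) 1 × ℝ × ℝ =>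
    auxX p.1 p.2.1 p.2.2) := by
  refine continuous_matrix fun i j => ?_
  simp only [auxX_apply]
  have h : ∀ i j, Continuous (fun p : Metric.sphere (0 : ℍ[ℝ]) 1 × ℝ × ℝ => auxR p.1 i j) :=
    fun i j => (auxR_cont.matrix_elem i j).comp (by fun_prop)
  have := h 0 i
  have := h 0 j
  have := h 1 i
  have := h 1 j
  fun_prop

theorem auxX_symm (u : Metric.sphere (0 : ℍ[ℝ]) 1) (l m : ℝ) : (auxX u l m)ᵀ = auxX u l m := by
  ext i j
  simp only [Matrix.transpose_apply, auxX_apply]; ring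

theorem auxX_trace (u : Metric.sphere (0 : ℍ[ℝ]) 1) (l m : ℝ) : (auxX u l m).trace = l - m := by
  rw [auxX, Matrix.trace_mul_comm, ← Matrix.mul_assoc, auxR_orth, Matrix.one_mul,
    Matrix.trace_diagonal, Fin.sum_univ_three]
  simp; ring

theorem auxX_trace_sq (u : Metric.sphere (0 : ℍ[ℝ]) 1) (l m : ℝ) :
    (auxX u l m * auxX u l m).trace = l ^ 2 + m ^ 2 := by
  have : auxX u l m * auxX u l m = (auxR u)ᵀ * (Matrix.diagonal ![l, -m, 0] *
      Matrix.diagonal ![l, -m, 0]) * auxR u := by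
    simp only [auxX, Matrix.mul_assoc]
    rw [← Matrix.mul_assoc (auxR u), auxR_orth, Matrix.one_mul]
  rw [this, Matrix.trace_mul_comm, ← Matrix.mul_assoc, auxR_orth, Matrix.one_mul,
    Matrix.diagonal_mul_diagonal, Matrix.trace_diagonal, Fin.sum_univ_three]
  simp; ring

/-- sum of the two absolute eigenvalues -/
noncomputable def auxS (x : Matrix (Fin 3) (Fin 3) ℝ) : ℝ := √(2 * (x * x).trace - x.trace ^ 2)

theorem auxS_X (u : Metric.sphere (0 : ℍ[ℝ]) 1) (l m : ℝ) (hl : 0 < l) (hm : 0 < m) :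
    auxS (auxX u l m) = l + m := by
  rw [auxS, auxX_trace, auxX_trace_sq, Real.sqrt_eq_iff_mul_self_eq_of_pos (by positivity)]
  ring

/-- from an orthonormal pair to a unit quaternion -/
theorem auxX_exists (p q : Fin 3 → ℝ) (hp : p ⬝ᵥ p = 1) (hq : q ⬝ᵥ q = 1) (hpq : p ⬝ᵥ q = 0) :
    ∃ u : Metric.sphere (0 : ℍ[ℝ]) 1, ∀ l m : ℝ, ∀ i j,
      auxX u l m i j = l * p i * p j - m * q i * q j := by
  simp only [dotProduct, Fin.sum_univ_three] at hp hq hpq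
  obtain ⟨u, hu⟩ := auxR_surj (Matrix.of ![p, q, ![p 1 * q 2 - p 2 * q 1, p 2 * q 0 - p 0 * q 2,
    p 0 * q 1 - p 1 * q 0]]) (by
      ext i j
      fin_cases i <;> fin_cases j <;>
        simp [Matrix.mul_apply, Fin.sum_univ_three] <;> grind) (by
      simp [Matrix.det_fin_three]
      grind)
  refine ⟨u, fun l m i j => ?_⟩
  rw [auxX_apply, hu]
  simp

theorem auxX_inj (u v : Metric.sphere (0 : ℍ[ℝ]) 1) (l m : ℝ) (hl : 0 < l) (hm : 0 < m)
    (h : auxX u l m = auxX v l m) : ∀ i j, i ≠ j → auxR (u * v⁻¹ : Metric.sphere (0 : ℍ[ℝ]) 1) i j = 0 := by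
  set w := u * v⁻¹ with hw
  have hu : u = w * v := by simp [hw]
  have h1 : Matrix.diagonal ![l, -m, 0] * auxR w = auxR w * Matrix.diagonal ![l, -m, 0] := by
    have h2 : auxR v * auxX u l m * (auxR v)ᵀ = auxR v * auxX v l m * (auxR v)ᵀ := by rw [h]
    have h3 : auxR v * auxX v l m * (auxR v)ᵀ = Matrix.diagonal ![l, -m, 0] := by
      simp only [auxX, Matrix.mul_assoc, auxR_orth, Matrix.mul_one]
      rw [← Matrix.mul_assoc, auxR_orth, Matrix.one_mul]
    have h4 : auxR v * auxX u l m * (auxR v)ᵀ = (auxR w)ᵀ * (Matrix.diagonal ![l, -m, 0] * auxR w) := by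
      rw [hu, auxX, Metric.unitSphere.coe_mul, auxR_mul, Matrix.transpose_mul]
      simp only [Matrix.mul_assoc, auxR_orth, Matrix.mul_one]
      rw [← Matrix.mul_assoc (auxR v), auxR_orth, Matrix.one_mul]
    have h5 := h4.symm.trans (h2.trans h3)
    have h6 := congrArg (auxR w * ·) h5
    simp only [← Matrix.mul_assoc, auxR_orth, Matrix.one_mul] at h6
    exact h6
  intro i j hij
  have h2 := congrFun (congrFun h1 i) j
  rw [Matrix.diagonal_mul, Matrix.mul_diagonal] at h2
  have h3 : ((![l, -m, 0] : Fin 3 → ℝ) i - (![l, -m, 0] : Fin 3 → ℝ) j) * auxR w i j = 0 := by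
    linarith
  refine (mul_eq_zero.1 h3).resolve_left ?_
  fin_cases i <;> fin_cases j <;> simp at hij ⊢ <;> intro h <;> linarith

/-- A unit quaternion with diagonal rotation matrix is one of the eight units. -/
theorem aux_units (w : Metric.sphere (0 : ℍ[ℝ]) 1) (h : ∀ i j, i ≠ j → auxR w i j = 0) :
    (w : ℍ[ℝ]) = auxQ 1 0 0 0 ∨ (w : ℍ[ℝ]) = auxQ (-1) 0 0 0 ∨
    (w : ℍ[ℝ]) = auxQ 0 1 0 0 ∨ (w : ℍ[ℝ]) = auxQ 0 (-1) 0 0 ∨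
    (w : ℍ[ℝ]) = auxQ 0 0 1 0 ∨ (w : ℍ[ℝ]) = auxQ 0 0 (-1) 0 ∨
    (w : ℍ[ℝ]) = auxQ 0 0 0 1 ∨ (w : ℍ[ℝ]) = auxQ 0 0 0 (-1) := by
  have hs := aux_sphere_sq w
  have h01 := h 0 1 (by decide)
  have h10 := h 1 0 (by decide)
  have h02 := h 0 2 (by decide)
  have h20 := h 2 0 (by decide)
  have h12 := h 1 2 (by decide)
  have h21 := h 2 1 (by decide)
  simp only [auxR] at h01 h10 h02 h20 h12 h21
  simp at h01 h10 h02 h20 h12 h21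
  simp only [Quaternion.ext_iff, auxQ_re, auxQ_imI, auxQ_imJ, auxQ_imK]
  generalize (w : ℍ[ℝ]).re = a at *
  generalize (w : ℍ[ℝ]).imI = b at *
  generalize (w : ℍ[ℝ]).imJ = c at *
  generalize (w : ℍ[ℝ]).imK = d at *
  have ab : a * b = 0 := by linarith
  have ac : a * c = 0 := by linarith
  have ad : a * d = 0 := by linarith
  have bc : b * c = 0 := by linarith
  have bd : b * d = 0 := by linarith
  have cd : c * d = 0 := by linarith
  by_cases ha : a = 0
  · by_cases hb : b = 0
    · by_cases hc : c = 0
      · have : d = 1 ∨ d = -1 := sq_eq_one_iff.1 (by subst_vars; linarith)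
        grind
      · have hd : d = 0 := by simpa [hc] using cd
        have : c = 1 ∨ c = -1 := sq_eq_one_iff.1 (by subst_vars; linarith)
        grind
    · have hc : c = 0 := by simpa [hb] using bc
      have hd : d = 0 := by simpa [hb] using bd
      have : b = 1 ∨ b = -1 := sq_eq_one_iff.1 (by subst_vars; linarith)
      grind
  · have hb : b = 0 := by simpa [ha] using ab
    have hc : c = 0 := by simpa [ha] using ac
    have hd : d = 0 := by simpa [ha] using ad
    have : a = 1 ∨ a = -1 := sq_eq_one_iff.1 (by subst_vars; linarith)
    grind

theorem aux_eig (l : Fin 3 → ℝ) (h0 : l 0 * l 1 * l 2 = 0)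
    (h1 : l 0 * l 1 + l 0 * l 2 + l 1 * l 2 < 0) :
    ∃ k₀ k₁ : Fin 3, k₀ ≠ k₁ ∧ 0 < l k₀ ∧ l k₁ < 0 ∧
      ∀ f : Fin 3 → ℝ, ∑ k, l k * f k = l k₀ * f k₀ + l k₁ * f k₁ := by
  simp only [Fin.sum_univ_three]
  rcases mul_eq_zero.1 h0 with h | h
  · rcases mul_eq_zero.1 h with h | h
    · rcases mul_neg_iff.1 (show l 1 * l 2 < 0 by rw [h] at h1; linarith) with h' | h'
      · exact ⟨1, 2, by decide, h'.1, h'.2, fun f => by rw [h]; ring⟩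
      · exact ⟨2, 1, by decide, h'.2, h'.1, fun f => by rw [h]; ring⟩
    · rcases mul_neg_iff.1 (show l 0 * l 2 < 0 by rw [h] at h1; linarith) with h' | h'
      · exact ⟨0, 2, by decide, h'.1, h'.2, fun f => by rw [h]; ring⟩
      · exact ⟨2, 0, by decide, h'.2, h'.1, fun f => by rw [h]; ring⟩
  · rcases mul_neg_iff.1 (show l 0 * l 1 < 0 by rw [h] at h1; linarith) with h' | h'
    · exact ⟨0, 1, by decide, h'.1, h'.2, fun f => by rw [h]; ring⟩
    · exact ⟨1, 0, by decide, h'.2, h'.1, fun f => by rw [h]; ring⟩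

theorem aux_cone_apply (g : Matrix (Fin 3) (Fin 3) ℝ) (i j : Fin 3) :
    (g * signatureDiag 3 1 1 * gᵀ) i j = g i 0 * g j 0 - g i 1 * g j 1 := by
  simp [signatureDiag, Matrix.mul_apply, Fin.sum_univ_three, Matrix.diagonal]
  ring

theorem aux_cone_exists (x : Matrix (Fin 3) (Fin 3) ℝ) (hx : x ∈ sigCone 3 1 1) :
    ∃ u : Metric.sphere (0 : ℍ[ℝ]) 1, ∃ a b : ℝ, x = auxX u (Real.exp a) (Real.exp b) := by
  obtain ⟨g, hg, hxg⟩ := hx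
  have hxa : ∀ i j, x i j = g i 0 * g j 0 - g i 1 * g j 1 := fun i j => by
    rw [hxg, aux_cone_apply]
  have hsymm : x.IsHermitian := by
    ext i j
    simp only [Matrix.conjTranspose_apply, hxa, star_trivial]; ring
  have hdet : g.det ≠ 0 := ((Matrix.isUnit_iff_isUnit_det g).1 hg).ne_zero
  set c0 := g 1 0 * g 2 1 - g 2 0 * g 1 1 with hc0
  set c1 := g 2 0 * g 0 1 - g 0 0 * g 2 1 with hc1
  set c2 := g 0 0 * g 1 1 - g 1 0 * g 0 1 with hc2
  have hc : 0 < c0 ^ 2 + c1 ^ 2 + c2 ^ 2 := by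
    by_contra hcon
    have z0 : c0 = 0 := by nlinarith [sq_nonneg c0, sq_nonneg c1, sq_nonneg c2]
    have z1 : c1 = 0 := by nlinarith [sq_nonneg c0, sq_nonneg c1, sq_nonneg c2]
    have z2 : c2 = 0 := by nlinarith [sq_nonneg c0, sq_nonneg c1, sq_nonneg c2]
    apply hdet
    have : g.det = c0 * g 0 2 + c1 * g 1 2 + c2 * g 2 2 := by
      rw [Matrix.det_fin_three]; ring
    rw [this, z0, z1, z2]; ring
  have i1 : x.trace ^ 2 - (x * x).trace = -2 * (c0 ^ 2 + c1 ^ 2 + c2 ^ 2) := by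
    simp only [Matrix.trace_fin_three, Matrix.mul_apply, Fin.sum_univ_three, hxa]
    ring
  have i2 : x.det = 0 := by
    rw [Matrix.det_fin_three]
    simp only [hxa]
    ring
  -- spectral decomposition
  set l := hsymm.eigenvalues with hl
  set U : Matrix (Fin 3) (Fin 3) ℝ := (hsymm.eigenvectorUnitary : Matrix (Fin 3) (Fin 3) ℝ) with hU
  have hUU : Uᵀ * U = 1 := by
    have := (Matrix.mem_unitaryGroup_iff' (A := U)).1 hsymm.eigenvectorUnitary.2
    rwa [Matrix.star_eq_conjTranspose, Matrix.conjTranspose_eq_transpose_of_trivial] at this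
  have hspec : x = U * Matrix.diagonal l * Uᵀ := by
    have := hsymm.spectral_theorem
    rw [Unitary.conjStarAlgAut_apply, Matrix.star_eq_conjTranspose,
      Matrix.conjTranspose_eq_transpose_of_trivial] at this
    exact this
  have j1 : x.trace = l 0 + l 1 + l 2 := by
    rw [hspec, Matrix.trace_mul_comm, ← Matrix.mul_assoc, hUU, Matrix.one_mul,
      Matrix.trace_diagonal, Fin.sum_univ_three]
  have j2 : (x * x).trace = l 0 ^ 2 + l 1 ^ 2 + l 2 ^ 2 := by
    have : x * x = U * (Matrix.diagonal l * Matrix.diagonal l) * Uᵀ := by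
      conv_lhs => rw [hspec]
      simp only [Matrix.mul_assoc]
      rw [← Matrix.mul_assoc Uᵀ, hUU, Matrix.one_mul]
    rw [this, Matrix.trace_mul_comm, ← Matrix.mul_assoc, hUU, Matrix.one_mul,
      Matrix.diagonal_mul_diagonal, Matrix.trace_diagonal, Fin.sum_univ_three]
    ring
  have j3 : x.det = l 0 * l 1 * l 2 := by
    have h := congrArg Matrix.det hUU
    rw [Matrix.det_mul, Matrix.det_transpose, Matrix.det_one] at h
    rw [hspec, Matrix.det_mul, Matrix.det_mul, Matrix.det_transpose, Matrix.det_diagonal,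
      Fin.prod_univ_three]
    linear_combination (l 0 * l 1 * l 2) * h
  obtain ⟨k₀, k₁, hk, hp, hn, hsum⟩ := aux_eig l (by rw [← j3, i2]) (by
    rw [j1, j2] at i1
    nlinarith)
  have ho : ∀ i j, (fun r => U r i) ⬝ᵥ (fun r => U r j) = (1 : Matrix (Fin 3) (Fin 3) ℝ) i j := by
    intro i j
    rw [← hUU]; rfl
  obtain ⟨u, hu⟩ := auxX_exists (fun r => U r k₀) (fun r => U r k₁)
    (by rw [ho, Matrix.one_apply_eq]) (by rw [ho, Matrix.one_apply_eq])
    (by rw [ho, Matrix.one_apply_ne hk])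
  refine ⟨u, Real.log (l k₀), Real.log (-l k₁), ?_⟩
  rw [Real.exp_log hp, Real.exp_log (by linarith)]
  ext i j
  rw [hu, hspec]
  have : (U * Matrix.diagonal l * Uᵀ) i j = ∑ k, l k * (U i k * U j k) := by
    rw [Matrix.mul_apply]
    refine Finset.sum_congr rfl fun k _ => ?_
    rw [Matrix.mul_diagonal, Matrix.transpose_apply]; ring
  rw [this, hsum]
  ring

theorem auxX_mem (u : Metric.sphere (0 : ℍ[ℝ]) 1) (a b : ℝ) :
    auxX u (Real.exp a) (Real.exp b) ∈ sigCone 3 1 1 := by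
  refine ⟨(auxR u)ᵀ * Matrix.diagonal ![Real.exp (a / 2), Real.exp (b / 2), 1], ?_, ?_⟩
  · rw [Matrix.isUnit_iff_isUnit_det, Matrix.det_mul, Matrix.det_diagonal]
    refine IsUnit.mul ?_ ?_
    · rw [← Matrix.isUnit_iff_isUnit_det]
      exact IsUnit.of_mul_eq_one _ (auxR_orth' u)
    · simp [Fin.prod_univ_three]
  · ext i j
    rw [aux_cone_apply, auxX_apply]
    have ha : Real.exp a = Real.exp (a / 2) * Real.exp (a / 2) := by
      rw [← Real.exp_add]; ring_nf
    have hb : Real.exp b = Real.exp (b / 2) * Real.exp (b / 2) := by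
      rw [← Real.exp_add]; ring_nf
    rw [ha, hb]
    simp [Matrix.mul_diagonal]
    ring

/-- the eight units -/
def auxPhi0 : Fin 4 → ℍ[ℝ] :=
  ![auxQ 1 0 0 0, auxQ 0 1 0 0, auxQ (-1) 0 0 0, auxQ 0 (-1) 0 0]

/-- the eight units, second half -/
def auxPhi1 : Fin 4 → ℍ[ℝ] :=
  ![auxQ 0 0 1 0, auxQ 0 0 0 (-1), auxQ 0 0 (-1) 0, auxQ 0 0 0 1]

theorem auxQ_mul (a b c d a' b' c' d' : ℝ) : auxQ a b c d * auxQ a' b' c' d' =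
    auxQ (a * a' - b * b' - c * c' - d * d') (a * b' + b * a' + c * d' - d * c')
      (a * c' - b * d' + c * a' + d * b') (a * d' + b * c' - c * b' + d * a') := by
  ext <;> simp [auxQ_re, auxQ_imI, auxQ_imJ, auxQ_imK]

/-- the embedding of the quaternion group -/
def auxPhi : QuaternionGroup 2 → ℍ[ℝ]
  | .a k => auxPhi0 k
  | .xa k => auxPhi1 k

theorem auxPhi_norm (g : QuaternionGroup 2) : auxPhi g ∈ Metric.sphere (0 : ℍ[ℝ]) 1 := by
  have key : ∀ a b c d (h : a ^ 2 + b ^ 2 + c ^ 2 + d ^ 2 = 1), auxQ a b c d ∈ Metric.sphere (0 : ℍ[ℝ]) 1 :=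
    fun a b c d h => (auxU a b c d h).2
  rcases g with k | k
  · change auxPhi0 k ∈ _
    change Fin 4 at k
    fin_cases k <;> exact key _ _ _ _ (by norm_num)
  · change auxPhi1 k ∈ _
    change Fin 4 at k
    fin_cases k <;> exact key _ _ _ _ (by norm_num)

theorem auxPhi_mul (g h : QuaternionGroup 2) : auxPhi (g * h) = auxPhi g * auxPhi h := by
  rcases g with i | i <;> rcases h with j | j
  · rw [QuaternionGroup.a_mul_a]
    change Fin 4 at i j
    change auxPhi0 (i + j) = auxPhi0 i * auxPhi0 j
    fin_cases i <;> fin_cases j <;> simp [auxPhi0, auxQ_mul]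
  · rw [QuaternionGroup.a_mul_xa]
    change Fin 4 at i j
    change auxPhi1 (j - i) = auxPhi0 i * auxPhi1 j
    fin_cases i <;> fin_cases j <;> simp [auxPhi0, auxPhi1, auxQ_mul]
  · rw [QuaternionGroup.xa_mul_a]
    change Fin 4 at i j
    change auxPhi1 (i + j) = auxPhi1 i * auxPhi0 j
    fin_cases i <;> fin_cases j <;> simp [auxPhi0, auxPhi1, auxQ_mul]
  · rw [QuaternionGroup.xa_mul_xa]
    change Fin 4 at i j
    change auxPhi0 (2 + j - i) = auxPhi1 i * auxPhi1 j
    fin_cases i <;> fin_cases j <;> simp [auxPhi0, auxPhi1, auxQ_mul]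

/-- the embedding of the quaternion group in the unit quaternions -/
noncomputable def auxPhiHom : QuaternionGroup 2 →* Metric.sphere (0 : ℍ[ℝ]) 1 :=
  MonoidHom.mk' (fun g => ⟨auxPhi g, auxPhi_norm g⟩) (fun g h => Subtype.ext (auxPhi_mul g h))

theorem auxPhiHom_coe (g) : (auxPhiHom g : ℍ[ℝ]) = auxPhi g := rfl

theorem auxPhi_eq_one (g : QuaternionGroup 2) (h : auxPhiHom g = 1) : g = 1 := by
  have h' : (auxPhi g).re = 1 := by rw [← auxPhiHom_coe, h]; simp
  rcases g with k | k
  · change (auxPhi0 k).re = 1 at h'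
    change Fin 4 at k
    fin_cases k <;> simp [auxPhi0, auxQ_re] at h'
    · rfl
    · norm_num at h'
  · change (auxPhi1 k).re = 1 at h'
    change Fin 4 at k
    fin_cases k <;> simp [auxPhi1, auxQ_re] at h'

theorem auxPhi_surj (w : Metric.sphere (0 : ℍ[ℝ]) 1) (h : ∀ i j, i ≠ j → auxR w i j = 0) :
    ∃ g, auxPhiHom g = w := by
  suffices ∃ g, auxPhi g = w by
    obtain ⟨g, hg⟩ := this
    exact ⟨g, Subtype.ext hg⟩
  rcases aux_units w h with h | h | h | h | h | h | h | h <;> rw [h]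
  · exact ⟨.a (0 : Fin 4), rfl⟩
  · exact ⟨.a (2 : Fin 4), rfl⟩
  · exact ⟨.a (1 : Fin 4), rfl⟩
  · exact ⟨.a (3 : Fin 4), rfl⟩
  · exact ⟨.xa (0 : Fin 4), rfl⟩
  · exact ⟨.xa (2 : Fin 4), rfl⟩
  · exact ⟨.xa (3 : Fin 4), rfl⟩
  · exact ⟨.xa (1 : Fin 4), rfl⟩

theorem auxX_phi (g : QuaternionGroup 2) (u : Metric.sphere (0 : ℍ[ℝ]) 1) (l m : ℝ) :
    auxX (auxPhiHom g * u) l m = auxX u l m := by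
  have key : (auxR (auxPhi g))ᵀ * Matrix.diagonal ![l, -m, 0] * auxR (auxPhi g) =
      Matrix.diagonal ![l, -m, 0] := by
    ext i j
    rcases g with k | k
    · change ((auxR (auxPhi0 k))ᵀ * Matrix.diagonal ![l, -m, 0] * auxR (auxPhi0 k)) i j = _
      change Fin 4 at k
      fin_cases k <;> fin_cases i <;> fin_cases j <;>
        simp [auxPhi0, auxR, auxQ_re, auxQ_imI, auxQ_imJ, auxQ_imK, Matrix.mul_apply,
          Fin.sum_univ_three, Matrix.diagonal]
    · change ((auxR (auxPhi1 k))ᵀ * Matrix.diagonal ![l, -m, 0] * auxR (auxPhi1 k)) i j = _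
      change Fin 4 at k
      fin_cases k <;> fin_cases i <;> fin_cases j <;>
        simp [auxPhi1, auxR, auxQ_re, auxQ_imI, auxQ_imJ, auxQ_imK, Matrix.mul_apply,
          Fin.sum_univ_three, Matrix.diagonal]
  rw [auxX, Metric.unitSphere.coe_mul, auxR_mul, Matrix.transpose_mul, auxPhiHom_coe]
  have : (auxR u)ᵀ * (auxR (auxPhi g))ᵀ * Matrix.diagonal ![l, -m, 0] *
      (auxR (auxPhi g) * auxR u) = (auxR u)ᵀ * ((auxR (auxPhi g))ᵀ *
      Matrix.diagonal ![l, -m, 0] * auxR (auxPhi g)) * auxR u := by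
    simp only [Matrix.mul_assoc]
  rw [this, key, auxX]

/-- Real symmetric matrices. -/
abbrev AuxSym : Type := {y : Matrix (Fin 3) (Fin 3) ℝ // yᵀ = y}

/-- The universal covering space. -/
abbrev AuxE : Type := Metric.sphere (0 : ℍ[ℝ]) 1 × (ℝ × ℝ × AuxSym)

theorem auxSym_contr : ContractibleSpace AuxSym := by
  have h : Convex ℝ {y : Matrix (Fin 3) (Fin 3) ℝ | yᵀ = y} := by
    intro x hx y hy a b _ _ _
    simp only [Set.mem_setOf_eq] at *
    rw [transpose_add, transpose_smul, transpose_smul, hx, hy]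
  exact h.contractibleSpace ⟨0, by simp⟩

theorem auxE_sc : SimplyConnectedSpace AuxE := by
  haveI := auxSym_contr
  haveI : ContractibleSpace (ℝ × ℝ × AuxSym) := inferInstance
  exact aux_simplyConnected_of_prod.2 aux_sphere_sc

theorem auxSym_lc : LocallyCompactSpace AuxSym := by
  haveI : LocallyCompactSpace (Matrix (Fin 3) (Fin 3) ℝ) :=
    inferInstanceAs (LocallyCompactSpace (Fin 3 → Fin 3 → ℝ))
  have h : IsClosed {y : Matrix (Fin 3) (Fin 3) ℝ | yᵀ = y} :=
    isClosed_eq (continuous_id.matrix_transpose) continuous_id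
  exact h.isClosedEmbedding_subtypeVal.locallyCompactSpace

noncomputable instance auxAct : MulAction (QuaternionGroup 2) AuxE where
  smul g e := (auxPhiHom g * e.1, e.2)
  one_smul e := by
    change (auxPhiHom 1 * e.1, e.2) = e
    rw [map_one, one_mul]
  mul_smul g h e := by
    change (auxPhiHom (g * h) * e.1, e.2) = (auxPhiHom g * (auxPhiHom h * e.1), e.2)
    rw [map_mul, mul_assoc]

theorem auxAct_def (g : QuaternionGroup 2) (e : AuxE) : g • e = (auxPhiHom g * e.1, e.2) := rfl

instance auxAct_cont : ContinuousConstSMul (QuaternionGroup 2) AuxE where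
  continuous_const_smul g := by
    change Continuous (fun e : AuxE => (auxPhiHom g * e.1, e.2))
    fun_prop

instance auxAct_cancel : IsCancelSMul (QuaternionGroup 2) AuxE := by
  rw [isCancelSMul_iff_eq_one_of_smul_eq]
  intro g e h
  rw [auxAct_def] at h
  have h1 := congrArg Prod.fst h
  exact auxPhi_eq_one g (mul_eq_right.1 h1)

/-- Real part. -/
def auxRe (z : Matrix (Fin 3) (Fin 3) ℂ) : Matrix (Fin 3) (Fin 3) ℝ := z.map Complex.re
/-- Imaginary part. -/
def auxIm (z : Matrix (Fin 3) (Fin 3) ℂ) : Matrix (Fin 3) (Fin 3) ℝ := z.map Complex.im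

theorem auxTube_iff (z : Matrix (Fin 3) (Fin 3) ℂ) :
    z ∈ sigTube 3 1 1 ↔ zᵀ = z ∧ auxRe z ∈ sigCone 3 1 1 := by
  have h : (Matrix.of fun i j => ((z + z.map (starRingEnd ℂ)) i j).re / 2) = auxRe z := by
    ext i j
    simp [auxRe]
  unfold sigTube
  rw [Set.mem_setOf_eq, h]

/-- Assembling a complex matrix. -/
def auxC (x y : Matrix (Fin 3) (Fin 3) ℝ) : Matrix (Fin 3) (Fin 3) ℂ :=
  Matrix.of fun i j => ⟨x i j, y i j⟩

theorem auxRe_C (x y) : auxRe (auxC x y) = x := rfl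
theorem auxIm_C (x y) : auxIm (auxC x y) = y := rfl
theorem auxC_eta (z) : auxC (auxRe z) (auxIm z) = z := rfl

theorem auxC_tr (x y) : (auxC x y)ᵀ = auxC xᵀ yᵀ := rfl

theorem auxC_cont : Continuous (fun p : Matrix (Fin 3) (Fin 3) ℝ × Matrix (Fin 3) (Fin 3) ℝ =>
    auxC p.1 p.2) := by
  refine continuous_matrix fun i j => ?_
  have : Continuous fun p : ℝ × ℝ => (⟨p.1, p.2⟩ : ℂ) :=
    Complex.equivRealProdCLM.symm.continuous
  exact this.comp ((continuous_fst.matrix_elem i j).prodMk (continuous_snd.matrix_elem i j))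

theorem auxRe_cont : Continuous auxRe := continuous_id.matrix_map Complex.continuous_re
theorem auxIm_cont : Continuous auxIm := continuous_id.matrix_map Complex.continuous_im

/-- The covering map. -/
noncomputable def auxF (e : AuxE) : sigTube 3 1 1 :=
  ⟨auxC (auxX e.1 (Real.exp e.2.1) (Real.exp e.2.2.1)) e.2.2.2.1, by
    rw [auxTube_iff]
    refine ⟨?_, ?_⟩
    · rw [auxC_tr, auxX_symm, e.2.2.2.2]
    · rw [auxRe_C]
      exact auxX_mem _ _ _⟩

theorem auxF_cont : Continuous auxF := by
  refine Continuous.subtype_mk ?_ _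
  refine auxC_cont.comp (Continuous.prodMk ?_ (by fun_prop))
  exact auxX_cont.comp (f := fun e : AuxE => (e.1, Real.exp e.2.1, Real.exp e.2.2.1)) (by fun_prop)

theorem auxIm_symm (z : sigTube 3 1 1) : (auxIm z.1)ᵀ = auxIm z.1 :=
  congrArg auxIm ((auxTube_iff z.1).1 z.2).1

theorem auxF_surj : Function.Surjective auxF := by
  intro z
  obtain ⟨h1, h2⟩ := (auxTube_iff z.1).1 z.2
  obtain ⟨u, a, b, h⟩ := aux_cone_exists _ h2
  refine ⟨(u, a, b, ⟨auxIm z.1, auxIm_symm z⟩), Subtype.ext ?_⟩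
  change auxC (auxX u (Real.exp a) (Real.exp b)) (auxIm z.1) = z.1
  rw [← h, auxC_eta]

/-- Positive eigenvalue. -/
noncomputable def auxA (z : sigTube 3 1 1) : ℝ := (auxS (auxRe z.1) + (auxRe z.1).trace) / 2
/-- Minus the negative eigenvalue. -/
noncomputable def auxB (z : sigTube 3 1 1) : ℝ := (auxS (auxRe z.1) - (auxRe z.1).trace) / 2

theorem auxA_F (e : AuxE) : auxA (auxF e) = Real.exp e.2.1 := by
  change (auxS (auxX e.1 (Real.exp e.2.1) (Real.exp e.2.2.1)) +
    (auxX e.1 (Real.exp e.2.1) (Real.exp e.2.2.1)).trace) / 2 = _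
  rw [auxS_X _ _ _ (Real.exp_pos _) (Real.exp_pos _), auxX_trace]
  ring

theorem auxB_F (e : AuxE) : auxB (auxF e) = Real.exp e.2.2.1 := by
  change (auxS (auxX e.1 (Real.exp e.2.1) (Real.exp e.2.2.1)) -
    (auxX e.1 (Real.exp e.2.1) (Real.exp e.2.2.1)).trace) / 2 = _
  rw [auxS_X _ _ _ (Real.exp_pos _) (Real.exp_pos _), auxX_trace]
  ring

theorem auxA_ne (z) : auxA z ≠ 0 := by
  obtain ⟨e, rfl⟩ := auxF_surj z
  rw [auxA_F]
  exact (Real.exp_pos _).ne'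

theorem auxB_ne (z) : auxB z ≠ 0 := by
  obtain ⟨e, rfl⟩ := auxF_surj z
  rw [auxB_F]
  exact (Real.exp_pos _).ne'

theorem auxS_cont : Continuous auxS := by
  unfold auxS
  have h1 : Continuous fun x : Matrix (Fin 3) (Fin 3) ℝ => (x * x).trace :=
    (continuous_id.matrix_mul continuous_id).matrix_trace
  have h2 : Continuous fun x : Matrix (Fin 3) (Fin 3) ℝ => x.trace := continuous_id.matrix_trace
  fun_prop

theorem auxA_cont : Continuous auxA := by
  have h0 : Continuous fun z : sigTube 3 1 1 => auxRe z.1 := auxRe_cont.comp continuous_subtype_val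
  have h1 := auxS_cont.comp h0
  have h2 := h0.matrix_trace
  exact (h1.add h2).div_const 2

theorem auxB_cont : Continuous auxB := by
  have h0 : Continuous fun z : sigTube 3 1 1 => auxRe z.1 := auxRe_cont.comp continuous_subtype_val
  have h1 := auxS_cont.comp h0
  have h2 := h0.matrix_trace
  exact (h1.sub h2).div_const 2

/-- The retraction. -/
noncomputable def auxP (z : sigTube 3 1 1) : ℝ × ℝ × AuxSym :=
  (Real.log (auxA z), Real.log (auxB z), ⟨auxIm z.1, auxIm_symm z⟩)

theorem auxP_cont : Continuous auxP := by
  refine (auxA_cont.log auxA_ne).prodMk ((auxB_cont.log auxB_ne).prodMk ?_)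
  exact Continuous.subtype_mk (auxIm_cont.comp continuous_subtype_val) _

theorem auxP_F (e : AuxE) : auxP (auxF e) = e.2 := by
  unfold auxP
  rw [auxA_F, auxB_F, Real.log_exp, Real.log_exp]
  rfl

theorem auxF_quot : Topology.IsQuotientMap auxF := by
  have h : Function.LeftInverse
      (fun p : Metric.sphere (0 : ℍ[ℝ]) 1 × sigTube 3 1 1 => ((p.1, auxP p.2) : AuxE))
      (fun e => (e.1, auxF e)) := by
    intro e
    change (e.1, auxP (auxF e)) = e
    rw [auxP_F]
  have hc := h.isClosedEmbedding
    (continuous_fst.prodMk (auxP_cont.comp continuous_snd))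
    (continuous_fst.prodMk auxF_cont)
  have h2 : IsClosedMap auxF :=
    (isClosedMap_snd_of_compactSpace (X := Metric.sphere (0 : ℍ[ℝ]) 1)
      (Y := sigTube 3 1 1)).comp hc.isClosedMap
  exact h2.isQuotientMap auxF_cont auxF_surj

theorem auxF_eq (e₁ e₂ : AuxE) : auxF e₁ = auxF e₂ ↔ e₁ ∈ MulAction.orbit (QuaternionGroup 2) e₂ := by
  constructor
  · intro h
    have h2 : e₁.2 = e₂.2 := by rw [← auxP_F e₁, h, auxP_F]
    have h3 : auxX e₁.1 (Real.exp e₁.2.1) (Real.exp e₁.2.2.1) =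
        auxX e₂.1 (Real.exp e₂.2.1) (Real.exp e₂.2.2.1) :=
      congrArg (fun z : sigTube 3 1 1 => auxRe z.1) h
    rw [h2] at h3
    obtain ⟨g, hg⟩ := auxPhi_surj _ (auxX_inj _ _ _ _ (Real.exp_pos _) (Real.exp_pos _) h3)
    refine ⟨g, ?_⟩
    change (auxPhiHom g * e₂.1, e₂.2) = e₁
    rw [hg, inv_mul_cancel_right, ← h2]
  · rintro ⟨g, rfl⟩
    refine Subtype.ext ?_
    change auxC (auxX (auxPhiHom g * e₂.1) (Real.exp e₂.2.1) (Real.exp e₂.2.2.1)) e₂.2.2.2.1 =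
      auxC (auxX e₂.1 (Real.exp e₂.2.1) (Real.exp e₂.2.2.1)) e₂.2.2.2.1
    rw [auxX_phi]

theorem auxF_cov : IsQuotientCoveringMap auxF (QuaternionGroup 2) := by
  haveI := auxSym_lc
  exact auxF_quot.isQuotientCoveringMap_of_properlyDiscontinuousSMul (auxF_eq _ _)

end AuxMaterial

/-- For `n = 3`, `p = q = 1`, the tube manifold `𝒯_{1,1}` is path-connected with
fundamental group the quaternion group `Q₈` of order `8`. -/
theorem tube_3_1_1_fundamentalGroup :
    PathConnectedSpace (sigTube 3 1 1) ∧
    ∀ x : sigTube 3 1 1,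
      Nonempty (FundamentalGroup (sigTube 3 1 1) x ≃* QuaternionGroup 2) := by
  haveI := auxE_sc
  refine ⟨auxF_surj.pathConnectedSpace auxF_cont, fun x => ?_⟩
  obtain ⟨e, he⟩ := auxF_surj x
  exact ⟨(auxF_cov.fundamentalGroupEquiv ⟨e, he⟩).trans (MulEquiv.inv' _).symm⟩
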